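/- Let σ > 0, η > 0 and 0 < r < 1, and let (x, y, z) : [0, ∞) → ℝ³ be any solution of the Lorenz system x' = σ(y − x), y' = r·x − y − x·z, z' = x·y − η·z. Then (x(t), y(t), z(t)) → (0, 0, 0) as t → ∞; i.e. all solutions converge to the origin. (This follows from the Lyapunov function V(x,y,z) = x²/σ + y² + z², whose derivative along solutions is −2x² + 2(1+r)xy − 2y² − 2ηz², a negative definite quadratic form when r < 1.) -/

import Mathlib

/-- A nonnegative function on `[0, ∞)` satisfying `V' ≤ -c V` with `c > 0` tends to `0`. -/
lemma tendsto_zero_of_hasDerivWithinAt_le_neg_mul {V V' : ℝ → ℝ} {c : ℝ} (hc : 0 < c)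
    (hV : ∀ t ∈ Set.Ici (0 : ℝ), HasDerivWithinAt V (V' t) (Set.Ici 0) t)
    (hV' : ∀ t ∈ Set.Ici (0 : ℝ), V' t ≤ -c * V t)
    (hV0 : ∀ t ∈ Set.Ici (0 : ℝ), 0 ≤ V t) :
    Filter.Tendsto V Filter.atTop (nhds 0) := by
  have hderiv : ∀ t ∈ Set.Ici (0 : ℝ), HasDerivWithinAt (fun s => Real.exp (c * s) * V s)
      (Real.exp (c * t) * (c * 1) * V t + Real.exp (c * t) * V' t) (Set.Ici 0) t :=
    fun t ht => (((hasDerivWithinAt_id t _).const_mul c).exp).mul (hV t ht)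
  have hanti : AntitoneOn (fun s => Real.exp (c * s) * V s) (Set.Ici 0) := by
    refine antitoneOn_of_hasDerivWithinAt_nonpos (convex_Ici 0)
      (fun t ht => (hderiv t ht).continuousWithinAt)
      (fun t ht => (hderiv t (interior_subset ht)).mono interior_subset) fun t ht => ?_
    have hle := hV' t (interior_subset ht)
    calc _ = Real.exp (c * t) * (c * V t + V' t) := by ring
      _ ≤ 0 := mul_nonpos_of_nonneg_of_nonpos (Real.exp_pos _).le (by linarith)
  have hlim : Filter.Tendsto (fun t => Real.exp (-(c * t)) * V 0) Filter.atTop (nhds 0) := by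
    simpa using (Real.tendsto_exp_neg_atTop_nhds_zero.comp
      (Filter.tendsto_id.const_mul_atTop hc)).mul_const (V 0)
  refine tendsto_of_tendsto_of_tendsto_of_le_of_le' tendsto_const_nhds hlim ?_ ?_
  · filter_upwards [Filter.eventually_ge_atTop 0] with t ht using hV0 t ht
  · filter_upwards [Filter.eventually_ge_atTop 0] with t ht
    have hle : Real.exp (c * t) * V t ≤ V 0 := by
      simpa using hanti Set.self_mem_Ici ht ht
    rw [Real.exp_neg, inv_mul_eq_div, le_div_iff₀ (Real.exp_pos _)]
    linarith

/-- If `f ^ 2` is bounded by a function tending to `0`, then `f` tends to `0`. -/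
lemma tendsto_zero_of_sq_le {f V : ℝ → ℝ} (h : ∀ t, f t ^ 2 ≤ V t)
    (hV : Filter.Tendsto V Filter.atTop (nhds 0)) :
    Filter.Tendsto f Filter.atTop (nhds 0) := by
  refine squeeze_zero_norm (fun t => Real.abs_le_sqrt (h t)) ?_
  simpa using hV.sqrt

/-- **Global asymptotic stability of the origin for `0 < r < 1`.**
For `σ > 0`, `η > 0` and `0 < r < 1`, every solution of the Lorenz system defined on
`[0, ∞)` converges to the origin as `t → ∞`. -/
theorem lorenz_solutions_tendsto_origin (σ r η : ℝ) (hσ : 0 < σ) (hη : 0 < η)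
    (hr0 : 0 < r) (hr1 : r < 1) (x y z : ℝ → ℝ)
    (hx : ∀ t ∈ Set.Ici (0 : ℝ),
      HasDerivWithinAt x (σ * (y t - x t)) (Set.Ici (0 : ℝ)) t)
    (hy : ∀ t ∈ Set.Ici (0 : ℝ),
      HasDerivWithinAt y (r * x t - y t - x t * z t) (Set.Ici (0 : ℝ)) t)
    (hz : ∀ t ∈ Set.Ici (0 : ℝ),
      HasDerivWithinAt z (x t * y t - η * z t) (Set.Ici (0 : ℝ)) t) :
    Filter.Tendsto (fun t => (x t, y t, z t)) Filter.atTop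
      (nhds ((0 : ℝ), (0 : ℝ), (0 : ℝ))) := by
  have hc : 0 < min ((1 - r) * min σ 1) (2 * η) := by
    have : 0 < 1 - r := by linarith
    positivity
  have hV : Filter.Tendsto (fun t => x t ^ 2 / σ + y t ^ 2 + z t ^ 2) Filter.atTop (nhds 0) := by
    refine tendsto_zero_of_hasDerivWithinAt_le_neg_mul hc
      (fun t ht => ((((hx t ht).pow 2).div_const σ).add ((hy t ht).pow 2)).add ((hz t ht).pow 2))
      (fun t _ => ?_) (fun t _ => by positivity)
    set c := min ((1 - r) * min σ 1) (2 * η)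
    have hr : 0 ≤ 1 - r := by linarith
    have hcσ : c ≤ (1 - r) * σ :=
      (min_le_left _ _).trans (mul_le_mul_of_nonneg_left (min_le_left _ _) hr)
    have hc1 : c ≤ (1 - r) * 1 :=
      (min_le_left _ _).trans (mul_le_mul_of_nonneg_left (min_le_right _ _) hr)
    have hcη : c ≤ 2 * η := min_le_right _ _
    have hxc : c * (x t ^ 2 / σ) ≤ (1 - r) * x t ^ 2 :=
      calc c * (x t ^ 2 / σ) ≤ (1 - r) * σ * (x t ^ 2 / σ) := by gcongr
        _ = (1 - r) * x t ^ 2 := by field_simp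
    have hyc : c * y t ^ 2 ≤ (1 - r) * 1 * y t ^ 2 := by gcongr
    have hzc : c * z t ^ 2 ≤ 2 * η * z t ^ 2 := by gcongr
    have hxy : 0 ≤ (1 + r) * (x t - y t) ^ 2 := by positivity
    calc _ = -2 * x t ^ 2 + 2 * (1 + r) * (x t * y t) - 2 * y t ^ 2 - 2 * η * z t ^ 2 := by
          field_simp
          ring
      _ ≤ -c * (x t ^ 2 / σ + y t ^ 2 + z t ^ 2) := by linarith
  refine Filter.Tendsto.prodMk_nhds ?_ (Filter.Tendsto.prodMk_nhds ?_ ?_)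
  · refine tendsto_zero_of_sq_le (fun t => ?_) (by simpa using hV.const_mul σ)
    calc x t ^ 2 = σ * (x t ^ 2 / σ) := by field_simp
      _ ≤ σ * (x t ^ 2 / σ + y t ^ 2 + z t ^ 2) := by
        gcongr
        linarith [sq_nonneg (y t), sq_nonneg (z t)]
  · refine tendsto_zero_of_sq_le (fun t => ?_) hV
    have : 0 ≤ x t ^ 2 / σ := by positivity
    linarith [sq_nonneg (z t)]
  · refine tendsto_zero_of_sq_le (fun t => ?_) hV
    have : 0 ≤ x t ^ 2 / σ := by positivity
    linarith [sq_nonneg (y t)]
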